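/- Assume (ξ, ζ) ≠ (0, 0). For every measurable C : ℝ² → ℝ with 0 < 𝔼[C(U, V)²] < ∞, one has |𝔼[X₁·C(U, V)]| / √(𝔼[C(U, V)²]) ≤ (ξ² + ζ² + 2ξζν)^{1/2} / (1 − ν²), and equality holds for the Bayes-optimal combiner C(u, v) = (ξ·u + ζ·v)/(1 − ν²). -/

import Mathlib

open MeasureTheory ProbabilityTheory Real Set

/-- The Cauchy–Schwarz inequality for square-integrable real functions. -/
lemma abs_integral_mul_le_sqrt_mul_sqrt {Ω : Type*} [MeasurableSpace Ω] {μ : Measure Ω}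
    {f g : Ω → ℝ} (hf : MemLp f 2 μ) (hg : MemLp g 2 μ) :
    |∫ ω, f ω * g ω ∂μ| ≤ √(∫ ω, f ω ^ 2 ∂μ) * √(∫ ω, g ω ^ 2 ∂μ) := by
  have hff := hf.integrable_sq
  have hgg := hg.integrable_sq
  have hfg : Integrable (fun ω => f ω * g ω) μ := hf.integrable_mul hg
  have key : ∀ t : ℝ, 0 ≤ (∫ ω, f ω ^ 2 ∂μ) * (t * t) + (2 * ∫ ω, f ω * g ω ∂μ) * t
      + ∫ ω, g ω ^ 2 ∂μ := by
    intro t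
    have h : ∫ ω, (t * f ω + g ω) ^ 2 ∂μ = (∫ ω, f ω ^ 2 ∂μ) * (t * t)
        + (2 * ∫ ω, f ω * g ω ∂μ) * t + ∫ ω, g ω ^ 2 ∂μ := by
      calc ∫ ω, (t * f ω + g ω) ^ 2 ∂μ
          = ∫ ω, ((t * t) * f ω ^ 2 + (2 * t) * (f ω * g ω) + g ω ^ 2) ∂μ := by
            congr 1; ext ω; ring
        _ = _ := by
            have hi : Integrable (fun ω => (t * t) * f ω ^ 2 + (2 * t) * (f ω * g ω)) μ :=
              (hff.const_mul _).add (hfg.const_mul _)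
            rw [integral_add hi hgg,
              integral_add (hff.const_mul _) (hfg.const_mul _), integral_const_mul,
              integral_const_mul]
            ring
    rw [← h]
    exact integral_nonneg fun ω => sq_nonneg _
  have hd := discrim_le_zero key
  rw [discrim] at hd
  rw [← Real.sqrt_mul (integral_nonneg fun ω => sq_nonneg _)]
  exact Real.abs_le_sqrt (by linarith)

/-- A random variable with centered Gaussian law is square-integrable. -/
lemma memLp_two_of_map_eq_gaussianReal {Ω : Type*} [MeasurableSpace Ω] {μ : Measure Ω}
    {Y : Ω → ℝ} (hY : Measurable Y) {v : NNReal} (h : μ.map Y = gaussianReal 0 v) :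
    MemLp Y 2 μ := by
  have h2 : MemLp id 2 (μ.map Y) := h ▸ memLp_id_gaussianReal' 2 (by simp)
  exact h2.comp_of_map hY.aemeasurable

lemma integral_eq_zero_of_map_eq_gaussianReal {Ω : Type*} [MeasurableSpace Ω] {μ : Measure Ω}
    {Y : Ω → ℝ} (hY : Measurable Y) {v : NNReal} (h : μ.map Y = gaussianReal 0 v) :
    ∫ ω, Y ω ∂μ = 0 := by
  rw [← integral_map (f := fun x : ℝ => x) hY.aemeasurable (by fun_prop), h,
    integral_id_gaussianReal]

lemma integral_sq_of_map_eq_gaussianReal {Ω : Type*} [MeasurableSpace Ω] {μ : Measure Ω}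
    {Y : Ω → ℝ} (hY : Measurable Y) {v : NNReal} (h : μ.map Y = gaussianReal 0 v) :
    ∫ ω, Y ω ^ 2 ∂μ = v := by
  rw [← integral_map (f := fun x : ℝ => x ^ 2) hY.aemeasurable (by fun_prop), h]
  have := variance_fun_id_gaussianReal (μ := 0) (v := v)
  rw [variance_eq_integral (by fun_prop)] at this
  simpa using this

/-- Three real random variables, all of whose linear combinations are centered Gaussian, are
jointly Gaussian. -/
lemma hasGaussianLaw_of_linear_combinations {Ω : Type*} [MeasurableSpace Ω] {μ : Measure Ω}
    {R U V : Ω → ℝ} (hR : Measurable R) (hU : Measurable U) (hV : Measurable V)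
    (h : ∀ a b c : ℝ, ∃ v : NNReal,
      μ.map (fun ω => a * R ω + b * U ω + c * V ω) = gaussianReal 0 v) :
    HasGaussianLaw (fun ω => (R ω, (U ω, V ω))) μ where
  isGaussian_map := by
    refine ⟨fun L => ?_⟩
    have hZ : Measurable (fun ω => (R ω, (U ω, V ω))) := by fun_prop
    have hL : (L : ℝ × ℝ × ℝ → ℝ) ∘ (fun ω => (R ω, (U ω, V ω))) =
        fun ω => L (1, 0, 0) * R ω + L (0, 1, 0) * U ω + L (0, 0, 1) * V ω := by
      ext ω
      have e : (R ω, (U ω, V ω)) = R ω • ((1, 0, 0) : ℝ × ℝ × ℝ) + U ω • (0, 1, 0)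
          + V ω • (0, 0, 1) := by simp
      simp only [Function.comp_apply]
      rw [e]
      simp only [map_add, map_smul, smul_eq_mul]
      ring
    obtain ⟨v, hv⟩ := h (L (1, 0, 0)) (L (0, 1, 0)) (L (0, 0, 1))
    have hmap : (μ.map (fun ω => (R ω, (U ω, V ω)))).map L = gaussianReal 0 v := by
      rw [Measure.map_map (by fun_prop) hZ, hL, hv]
    have hm : (μ.map (fun ω => (R ω, (U ω, V ω))))[L] = 0 :=
      integral_eq_zero_of_map_eq_gaussianReal (by fun_prop) hmap
    have hvar : Var[L; μ.map (fun ω => (R ω, (U ω, V ω)))] = v := by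
      rw [variance_eq_integral (by fun_prop), hm]
      simpa using integral_sq_of_map_eq_gaussianReal (by fun_prop) hmap
    rw [hm, hvar, hmap, Real.toNNReal_coe]

/-- In a centered jointly Gaussian triple, a variable orthogonal to the two others is
independent of them. -/
lemma indepFun_prodMk_of_linear_combinations {Ω : Type*} [MeasurableSpace Ω] {μ : Measure Ω}
    [IsProbabilityMeasure μ]
    {R U V : Ω → ℝ} (hR : Measurable R) (hU : Measurable U) (hV : Measurable V)
    (h : ∀ a b c : ℝ, ∃ v : NNReal,
      μ.map (fun ω => a * R ω + b * U ω + c * V ω) = gaussianReal 0 v)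
    (hRU : ∫ ω, R ω * U ω ∂μ = 0) (hRV : ∫ ω, R ω * V ω ∂μ = 0) :
    IndepFun R (fun ω => (U ω, V ω)) μ := by
  obtain ⟨r, hr⟩ := h 1 0 0
  obtain ⟨s, hs⟩ := h 0 1 0
  obtain ⟨t, ht⟩ := h 0 0 1
  simp only [one_mul, zero_mul, add_zero, zero_add] at hr hs ht
  have mR := memLp_two_of_map_eq_gaussianReal hR hr
  have mU := memLp_two_of_map_eq_gaussianReal hU hs
  have mV := memLp_two_of_map_eq_gaussianReal hV ht
  have cU : cov[R, U; μ] = 0 := by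
    rw [covariance_eq_sub mR mU, integral_eq_zero_of_map_eq_gaussianReal hR hr, zero_mul, sub_zero]
    exact hRU
  have cV : cov[R, V; μ] = 0 := by
    rw [covariance_eq_sub mR mV, integral_eq_zero_of_map_eq_gaussianReal hR hr, zero_mul, sub_zero]
    exact hRV
  refine (hasGaussianLaw_of_linear_combinations hR hU hV h).indepFun_of_covariance_strongDual
    fun L₁ L₂ => ?_
  have e1 : (L₁ : ℝ → ℝ) ∘ R = fun ω => L₁ 1 * R ω := by
    ext ω
    have e : R ω = R ω • (1 : ℝ) := by simp
    simp only [Function.comp_apply]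
    rw [e, map_smul]
    simp [mul_comm]
  have e2 : (L₂ : ℝ × ℝ → ℝ) ∘ (fun ω => (U ω, V ω)) =
      (fun ω => L₂ (1, 0) * U ω) + fun ω => L₂ (0, 1) * V ω := by
    ext ω
    have e : (U ω, V ω) = U ω • ((1, 0) : ℝ × ℝ) + V ω • (0, 1) := by simp
    simp only [Function.comp_apply, Pi.add_apply]
    rw [e]
    simp only [map_add, map_smul, smul_eq_mul]
    ring
  rw [e1, e2, covariance_const_mul_left, covariance_add_right mR (mU.const_mul _) (mV.const_mul _),
    covariance_const_mul_right, covariance_const_mul_right, cU, cV]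
  simp

/-- Second moments determine mixed moments: polarization for the form attached to
`(X₁, X₂, W, W')`. -/
lemma integral_mul_of_gaussian_combinations {Ω : Type*} [MeasurableSpace Ω] {μ : Measure Ω}
    {A B κ : ℝ} (hA : 0 < A) (hκ : κ ^ 2 ≤ A * B) {X₁ X₂ W W' : Ω → ℝ}
    (hX₁ : Measurable X₁) (hX₂ : Measurable X₂) (hW : Measurable W) (hW' : Measurable W')
    (hgauss : ∀ a b c d : ℝ,
      μ.map (fun ω => a * X₁ ω + b * X₂ ω + c * W ω + d * W' ω) =
        gaussianReal 0 (Real.toNNReal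
          (a ^ 2 + b ^ 2 + c ^ 2 * A + d ^ 2 * B + 2 * c * d * κ)))
    (a b c d a' b' c' d' : ℝ) :
    ∫ ω, (a * X₁ ω + b * X₂ ω + c * W ω + d * W' ω) *
        (a' * X₁ ω + b' * X₂ ω + c' * W ω + d' * W' ω) ∂μ =
      a * a' + b * b' + c * c' * A + d * d' * B + (c * d' + c' * d) * κ := by
  have hsq : ∀ a b c d : ℝ, ∫ ω, (a * X₁ ω + b * X₂ ω + c * W ω + d * W' ω) ^ 2 ∂μ =
      a ^ 2 + b ^ 2 + c ^ 2 * A + d ^ 2 * B + 2 * c * d * κ := by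
    intro a b c d
    rw [integral_sq_of_map_eq_gaussianReal (by fun_prop) (hgauss a b c d), Real.coe_toNNReal]
    have h : 0 ≤ A * (c ^ 2 * A + d ^ 2 * B + 2 * c * d * κ) := by
      nlinarith [sq_nonneg (c * A + d * κ), mul_nonneg (sq_nonneg d) (sub_nonneg.2 hκ)]
    have := nonneg_of_mul_nonneg_right h hA
    nlinarith [sq_nonneg a, sq_nonneg b]
  have hintegrable : ∀ a b c d : ℝ,
      Integrable (fun ω => (a * X₁ ω + b * X₂ ω + c * W ω + d * W' ω) ^ 2) μ := fun a b c d =>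
    (memLp_two_of_map_eq_gaussianReal (by fun_prop) (hgauss a b c d)).integrable_sq
  calc _ = ∫ ω, ((((a + a') * X₁ ω + (b + b') * X₂ ω + (c + c') * W ω + (d + d') * W' ω) ^ 2
        - (a * X₁ ω + b * X₂ ω + c * W ω + d * W' ω) ^ 2)
        - (a' * X₁ ω + b' * X₂ ω + c' * W ω + d' * W' ω) ^ 2) / 2 ∂μ := by
        congr 1; ext ω; ring
    _ = _ := by
        have hi : Integrable (fun ω =>
            ((a + a') * X₁ ω + (b + b') * X₂ ω + (c + c') * W ω + (d + d') * W' ω) ^ 2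
              - (a * X₁ ω + b * X₂ ω + c * W ω + d * W' ω) ^ 2) μ :=
          (hintegrable _ _ _ _).sub (hintegrable _ _ _ _)
        rw [integral_div, integral_sub hi (hintegrable _ _ _ _),
          integral_sub (hintegrable _ _ _ _) (hintegrable _ _ _ _), hsq, hsq, hsq]
        ring

/-- Optimality of the linear combiner: for any measurable combiner `C` with
`0 < 𝔼[C(U,V)²] < ∞`, the normalized correlation with `X₁` is at most
`√(ξ² + ζ² + 2ξζν)/(1 − ν²)`, with equality for the Bayes-optimal linear combiner. -/
theorem optimal_combiner_overlap
    {Ω : Type*} [MeasureSpace Ω] [IsProbabilityMeasure (ℙ : Measure Ω)]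
    (ρ₁ ρ₂ ρ κ : ℝ)
    (h12 : ρ₁ ^ 2 + ρ₂ ^ 2 < 1) (hρ : ρ ^ 2 < 1)
    (hκ : κ ^ 2 ≤ (1 - ρ₁ ^ 2 - ρ₂ ^ 2) * (1 - ρ ^ 2))
    (X₁ X₂ W W' : Ω → ℝ)
    (hX₁ : Measurable X₁) (hX₂ : Measurable X₂)
    (hW : Measurable W) (hW' : Measurable W')
    (hgauss : ∀ a b c d : ℝ,
      Measure.map (fun ω => a * X₁ ω + b * X₂ ω + c * W ω + d * W' ω) ℙ =
        gaussianReal 0 (Real.toNNReal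
          (a ^ 2 + b ^ 2 + c ^ 2 * (1 - ρ₁ ^ 2 - ρ₂ ^ 2) + d ^ 2 * (1 - ρ ^ 2)
            + 2 * c * d * κ)))
    (U V : Ω → ℝ)
    (hU : ∀ ω, U ω = ρ₁ * X₁ ω + ρ₂ * X₂ ω + W ω)
    (hV : ∀ ω, V ω = ρ * X₁ ω + W' ω)
    (ν ξ ζ : ℝ) (hν : ν = ρ₁ * ρ + κ) (hν1 : ν ^ 2 < 1)
    (hξ : ξ = ρ₁ - ρ * ν) (hζ : ζ = ρ - ρ₁ * ν)
    (hξζ : ¬(ξ = 0 ∧ ζ = 0)) :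
    (∀ C : ℝ → ℝ → ℝ, Measurable (Function.uncurry C) →
      Integrable (fun ω => (C (U ω) (V ω)) ^ 2) ℙ →
      0 < ∫ ω, (C (U ω) (V ω)) ^ 2 ∂ℙ →
      |∫ ω, X₁ ω * C (U ω) (V ω) ∂ℙ| /
          Real.sqrt (∫ ω, (C (U ω) (V ω)) ^ 2 ∂ℙ) ≤
        Real.sqrt (ξ ^ 2 + ζ ^ 2 + 2 * ξ * ζ * ν) / (1 - ν ^ 2)) ∧
    |∫ ω, X₁ ω * ((ξ * U ω + ζ * V ω) / (1 - ν ^ 2)) ∂ℙ| /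
        Real.sqrt (∫ ω, ((ξ * U ω + ζ * V ω) / (1 - ν ^ 2)) ^ 2 ∂ℙ) =
      Real.sqrt (ξ ^ 2 + ζ ^ 2 + 2 * ξ * ζ * ν) / (1 - ν ^ 2) := by
  have hd : 0 < 1 - ν ^ 2 := by linarith
  have hprod := integral_mul_of_gaussian_combinations (by linarith) hκ hX₁ hX₂ hW hW' hgauss
  have mU : Measurable U := by rw [funext hU]; fun_prop
  have mV : Measurable V := by rw [funext hV]; fun_prop
  set S : Ω → ℝ := fun ω => (ξ * U ω + ζ * V ω) / (1 - ν ^ 2) with hS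
  set R : Ω → ℝ := fun ω => X₁ ω - S ω with hR
  have mS : Measurable S := by fun_prop
  have mR : Measurable R := by fun_prop
  have comb : ∀ a b c : ℝ, ∃ v : NNReal,
      Measure.map (fun ω => a * R ω + b * U ω + c * V ω) ℙ = gaussianReal 0 v := by
    intro a b c
    refine ⟨_, Eq.trans ?_ (hgauss
      (a + (b - a * ξ / (1 - ν ^ 2)) * ρ₁ + (c - a * ζ / (1 - ν ^ 2)) * ρ)
      ((b - a * ξ / (1 - ν ^ 2)) * ρ₂) (b - a * ξ / (1 - ν ^ 2)) (c - a * ζ / (1 - ν ^ 2)))⟩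
    congr 1
    ext ω
    simp only [hR, hS, hU, hV]
    ring
  have mom : ∀ a b c a' b' c' : ℝ,
      ∫ ω, (a * X₁ ω + b * U ω + c * V ω) * (a' * X₁ ω + b' * U ω + c' * V ω) ∂ℙ =
      a * a' + b * b' + c * c' + (a * b' + a' * b) * ρ₁ + (a * c' + a' * c) * ρ
        + (b * c' + b' * c) * ν := by
    intro a b c a' b' c'
    have := hprod (a + b * ρ₁ + c * ρ) (b * ρ₂) b c (a' + b' * ρ₁ + c' * ρ) (b' * ρ₂) b' c'
    calc _ = _ := by
          congr 1; ext ω; rw [hU, hV]; ring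
      _ = _ := this
      _ = _ := by rw [hν]; ring
  have hsum₁ : ξ + ζ * ν = ρ₁ * (1 - ν ^ 2) := by rw [hξ, hζ]; ring
  have hsum₂ : ζ + ξ * ν = ρ * (1 - ν ^ 2) := by rw [hξ, hζ]; ring
  have hRU : ∫ ω, R ω * U ω ∂ℙ = 0 := by
    calc _ = _ := by
          congr 1; ext ω; simp only [hR, hS]; ring
      _ = _ := mom 1 (-ξ / (1 - ν ^ 2)) (-ζ / (1 - ν ^ 2)) 0 1 0
      _ = 0 := by field_simp; linarith
  have hRV : ∫ ω, R ω * V ω ∂ℙ = 0 := by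
    calc _ = _ := by
          congr 1; ext ω; simp only [hR, hS]; ring
      _ = _ := mom 1 (-ξ / (1 - ν ^ 2)) (-ζ / (1 - ν ^ 2)) 0 0 1
      _ = 0 := by field_simp; linarith
  have hXS : ∫ ω, X₁ ω * S ω ∂ℙ = (ξ ^ 2 + ζ ^ 2 + 2 * ξ * ζ * ν) / (1 - ν ^ 2) ^ 2 := by
    calc _ = _ := by
          congr 1; ext ω; simp only [hS]; ring
      _ = _ := mom 1 0 0 0 (ξ / (1 - ν ^ 2)) (ζ / (1 - ν ^ 2))
      _ = _ := by field_simp; linear_combination (-ξ) * hsum₁ - ζ * hsum₂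
  have hSS : ∫ ω, S ω ^ 2 ∂ℙ = (ξ ^ 2 + ζ ^ 2 + 2 * ξ * ζ * ν) / (1 - ν ^ 2) ^ 2 := by
    calc _ = _ := by
          congr 1; ext ω; simp only [hS]; ring
      _ = _ := mom 0 (ξ / (1 - ν ^ 2)) (ζ / (1 - ν ^ 2)) 0 (ξ / (1 - ν ^ 2)) (ζ / (1 - ν ^ 2))
      _ = _ := by field_simp; ring
  have hsqrt : √(∫ ω, S ω ^ 2 ∂ℙ) = √(ξ ^ 2 + ζ ^ 2 + 2 * ξ * ζ * ν) / (1 - ν ^ 2) := by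
    rw [hSS, Real.sqrt_div' _ (sq_nonneg _), Real.sqrt_sq hd.le]
  have hindep := indepFun_prodMk_of_linear_combinations mR mU mV comb hRU hRV
  obtain ⟨r, hr⟩ := comb 1 0 0
  simp only [one_mul, zero_mul, add_zero] at hr
  have R2 := memLp_two_of_map_eq_gaussianReal mR hr
  have S2 : MemLp S 2 ℙ := by
    obtain ⟨s, hs⟩ := comb 0 (ξ / (1 - ν ^ 2)) (ζ / (1 - ν ^ 2))
    have h := memLp_two_of_map_eq_gaussianReal (by fun_prop) hs
    convert h using 1
    ext ω
    simp only [hS]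
    ring
  rw [← hsqrt]
  constructor
  · intro C hC hintegrable hpos
    have mC : Measurable (fun ω => C (U ω) (V ω)) := hC.comp (mU.prodMk mV)
    have C2 : MemLp (fun ω => C (U ω) (V ω)) 2 ℙ :=
      (memLp_two_iff_integrable_sq mC.aestronglyMeasurable).2 hintegrable
    have hRC : ∫ ω, R ω * C (U ω) (V ω) ∂ℙ = 0 := by
      have hi : IndepFun R (fun ω => C (U ω) (V ω)) ℙ := hindep.comp measurable_id hC
      have := hi.integral_mul_eq_mul_integral mR.aestronglyMeasurable mC.aestronglyMeasurable
      rw [integral_eq_zero_of_map_eq_gaussianReal mR hr, zero_mul] at this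
      exact this
    have hXC : ∫ ω, X₁ ω * C (U ω) (V ω) ∂ℙ = ∫ ω, S ω * C (U ω) (V ω) ∂ℙ := by
      calc _ = ∫ ω, (R ω * C (U ω) (V ω) + S ω * C (U ω) (V ω)) ∂ℙ := by
            congr 1; ext ω; simp only [hR]; ring
        _ = _ := by
            have iR : Integrable (fun ω => R ω * C (U ω) (V ω)) ℙ := R2.integrable_mul C2
            have iS : Integrable (fun ω => S ω * C (U ω) (V ω)) ℙ := S2.integrable_mul C2
            rw [integral_add iR iS, hRC, zero_add]
    rw [div_le_iff₀ (Real.sqrt_pos.2 hpos), hXC]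
    exact abs_integral_mul_le_sqrt_mul_sqrt S2 C2
  · rw [hXS, ← hSS, abs_of_nonneg (integral_nonneg fun ω => sq_nonneg _), Real.div_sqrt]
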